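/- arXiv:1704.03671 — 3 statements merged into one kernel-verified Lean document; each statement's English description precedes it below -/
import Mathlib

section
/- Let V be a finite-dimensional complex vector space endowed with a nondegenerate symmetric or symplectic bilinear form ω, and let H ⊂ GL(V) be a subgroup such that for every g ∈ H, every invertible element of the unital subalgebra ℂ[g*g] of End(V) generated by g*g belongs to H (where f* denotes the adjoint of f with respect to ω). If two isotropic complete flags F and F' (i.e. elements of X_ω) lie in the same H-orbit of the complete flag variety X, then they lie in the same H ∩ G(V,ω)-orbit of X_ω. -/
noncomputable section

/-- The orthogonal complement `F^⊥ = {x | ω(x,y) = 0 for all y ∈ F}` of a subspace with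
respect to a bilinear form `ω`. -/
def perpB {V : Type*} [AddCommGroup V] [Module ℂ V]
    (ω : V →ₗ[ℂ] V →ₗ[ℂ] ℂ) (W : Submodule ℂ V) : Submodule ℂ V where
  carrier := {x | ∀ y ∈ W, ω x y = 0}
  add_mem' := by
    intro a b ha hb y hy
    rw [map_add, LinearMap.add_apply, ha y hy, hb y hy, add_zero]
  zero_mem' := by
    intro y hy
    rw [map_zero, LinearMap.zero_apply]
  smul_mem' := by
    intro c x hx y hy
    rw [map_smul, LinearMap.smul_apply, hx y hy, smul_zero]

open Polynomial in
theorem exists_mul_self_eq_of_isUnit {S : Type*} [CommRing S] [Algebra ℂ S]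
    [Module.Finite ℂ S] {a : S} (ha : IsUnit a) : ∃ s : S, s * s = a := by
  classical
  have hint : IsIntegral ℂ a := Algebra.IsIntegral.isIntegral a
  choose r hr using fun z : ℂ => IsAlgClosed.exists_pow_nat_eq z (n := 2) two_pos
  let p := minpoly ℂ a
  let q : ℂ[X] := Lagrange.interpolate p.roots.toFinset id r
  have hq : ∀ z ∈ p.roots, q.eval z = r z := fun z hz =>
    Lagrange.eval_interpolate_at_node (v := id) r (Set.injOn_id _) (Multiset.mem_toFinset.2 hz)
  have hdvd : p ∣ (q ^ 2 - X) ^ p.roots.card := by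
    have h := (IsAlgClosed.splits p).eq_prod_roots_of_monic (minpoly.monic hint)
    have hconst : (p.roots.map fun _ => q ^ 2 - X).prod = (q ^ 2 - X) ^ p.roots.card := by
      simp
    rw [← hconst]
    conv_lhs => rw [h]
    refine Multiset.prod_dvd_prod_of_dvd _ _ fun z hz => ?_
    rw [dvd_iff_isRoot]
    simp [hq z hz, hr]
  have hnil : IsNilpotent (aeval a q ^ 2 - a) := by
    refine ⟨p.roots.card, ?_⟩
    obtain ⟨c, hc⟩ := hdvd
    have := congrArg (aeval a) hc
    simpa [p, minpoly.aeval] using this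
  have hunit : IsUnit (aeval a q) := by
    have := hnil.isUnit_add_left_of_commute ha (Commute.all _ _)
    rw [add_sub_cancel] at this
    exact (isUnit_pow_iff two_ne_zero).1 this
  obtain ⟨s, ⟨-, hs⟩, -⟩ := existsUnique_nilpotent_sub_and_aeval_eq_zero
    (P := (X ^ 2 - C a : S[X])) (x := aeval a q) (by simpa using hnil) (by
      have h2 : IsUnit (2 : S) := by
        simpa only [map_ofNat] using (IsUnit.mk0 (2 : ℂ) two_ne_zero).map (algebraMap ℂ S)
      simpa [one_add_one_eq_two] using And.intro h2 hunit)
  exact ⟨s, by simpa [sub_eq_zero, sq] using hs⟩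

/-- An invertible endomorphism has a square root in the unital algebra it generates. -/
theorem exists_mul_self_eq_of_mem_adjoin {V : Type*} [AddCommGroup V] [Module ℂ V]
    [FiniteDimensional ℂ V] {a : Module.End ℂ V} (ha : IsUnit a) :
    ∃ s ∈ Algebra.adjoin ℂ {a}, s * s = a := by
  have hmem : a ∈ Algebra.adjoin ℂ {a} := Algebra.self_mem_adjoin_singleton ℂ a
  have : IsArtinianRing (Algebra.adjoin ℂ {a}) := IsArtinianRing.of_finite ℂ _
  have hu : IsUnit (⟨a, hmem⟩ : Algebra.adjoin ℂ {a}) := by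
    apply IsArtinianRing.isUnit_of_mem_nonZeroDivisors
    rw [mem_nonZeroDivisors_iff_right]
    intro x hx
    exact Subtype.ext (ha.mul_left_eq_zero.1 (congrArg Subtype.val hx))
  obtain ⟨s, hs⟩ := exists_mul_self_eq_of_isUnit hu
  exact ⟨s, s.2, congrArg Subtype.val hs⟩

theorem apply_mem_of_mem_adjoin {V : Type*} [AddCommGroup V] [Module ℂ V]
    {a f : Module.End ℂ V} (hf : f ∈ Algebra.adjoin ℂ {a}) {W : Submodule ℂ V}
    (ha : ∀ x ∈ W, a x ∈ W) : ∀ x ∈ W, f x ∈ W := by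
  induction hf using Algebra.adjoin_induction with
  | mem b hb => rwa [Set.mem_singleton_iff.1 hb]
  | algebraMap c => exact fun x hx => W.smul_mem c hx
  | add b c _ _ hb hc => exact fun x hx => W.add_mem (hb x hx) (hc x hx)
  | mul b c _ _ hb hc => exact fun x hx => hb _ (hc x hx)

theorem selfAdjoint_of_mem_adjoin {V : Type*} [AddCommGroup V] [Module ℂ V]
    {ω : V →ₗ[ℂ] V →ₗ[ℂ] ℂ} {a f : Module.End ℂ V} (hf : f ∈ Algebra.adjoin ℂ {a})
    (ha : ∀ x y, ω (a x) y = ω x (a y)) : ∀ x y, ω (f x) y = ω x (f y) := by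
  induction hf using Algebra.adjoin_induction with
  | mem b hb => rwa [Set.mem_singleton_iff.1 hb]
  | algebraMap c => simp [Module.algebraMap_end_apply]
  | add b c _ _ hb hc => simp [hb, hc]
  | mul b c hb' hc' hb hc =>
    intro x y
    have hcomm : b * c = c * b :=
      congrArg Subtype.val (mul_comm (⟨b, hb'⟩ : Algebra.adjoin ℂ {a}) ⟨c, hc'⟩)
    conv_rhs => rw [hcomm]
    simp [hb, hc]

/-- Let `V` be a finite-dimensional complex vector space with a nondegenerate
symmetric or symplectic bilinear form `ω`, and let `H ⊆ GL(V)` be a subgroup such that for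
every `g ∈ H`, every invertible element of the unital subalgebra `ℂ[g*g]` generated by
`g* g` belongs to `H` (where `adj f = f*` is the adjoint with respect to `ω`).  If two
isotropic complete flags `F, F'` (elements of `X_ω`) lie in the same `H`-orbit of the
complete flag variety `X`, then they lie in the same `H ∩ G(V,ω)`-orbit of `X_ω`. -/
theorem stmt_0 {V : Type*} [AddCommGroup V] [Module ℂ V] [FiniteDimensional ℂ V]
    (ω : V →ₗ[ℂ] V →ₗ[ℂ] ℂ)
    (hnd : ∀ x : V, (∀ y : V, ω x y = 0) → x = 0)
    (hsymp : (∀ x y : V, ω x y = ω y x) ∨ (∀ x y : V, ω x y = - ω y x))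
    (adj : Module.End ℂ V → Module.End ℂ V)
    (hadj : ∀ (f : Module.End ℂ V) (x y : V), ω (f x) y = ω x (adj f y))
    (H : Subgroup (Module.End ℂ V)ˣ)
    (hH : ∀ g ∈ H, ∀ u : (Module.End ℂ V)ˣ,
      (u : Module.End ℂ V) ∈
        Algebra.adjoin ℂ {adj (g : Module.End ℂ V) * (g : Module.End ℂ V)} → u ∈ H)
    (F F' : Fin (Module.finrank ℂ V + 1) → Submodule ℂ V)
    (hFflag : Monotone F ∧ ∀ k, Module.finrank ℂ (F k) = (k : ℕ))
    (hF'flag : Monotone F' ∧ ∀ k, Module.finrank ℂ (F' k) = (k : ℕ))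
    (hFiso : ∀ k, perpB ω (F k) = F (Fin.rev k))
    (hF'iso : ∀ k, perpB ω (F' k) = F' (Fin.rev k))
    (g : (Module.End ℂ V)ˣ) (hg : g ∈ H)
    (hgF : ∀ k, Submodule.map (g : Module.End ℂ V) (F k) = F' k) :
    ∃ h : (Module.End ℂ V)ˣ, h ∈ H ∧
      (∀ x y : V, ω ((h : Module.End ℂ V) x) ((h : Module.End ℂ V) y) = ω x y) ∧
      ∀ k, Submodule.map (h : Module.End ℂ V) (F k) = F' k := by
  have hsw : ∀ x y, ω (adj g x) y = ω x ((g : Module.End ℂ V) y) := by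
    intro x y
    rcases hsymp with h | h
    · rw [h, ← hadj, h]
    · rw [h, ← hadj, h, neg_neg]
  have hmapg : ∀ k, ∀ x ∈ F k, (g : Module.End ℂ V) x ∈ F' k := fun k x hx =>
    hgF k ▸ Submodule.mem_map_of_mem hx
  have hadjF : ∀ k, ∀ y ∈ F' k, adj g y ∈ F k := by
    intro k y hy
    rw [← Fin.rev_rev k, ← hFiso]
    intro x hx
    rw [← Fin.rev_rev k, ← hF'iso] at hy
    rw [hsw]
    exact hy _ (hmapg _ x hx)
  have hinj : Function.Injective (adj g * (g : Module.End ℂ V)) := by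
    rw [injective_iff_map_eq_zero]
    intro x hx
    apply hnd
    intro y
    have hgx : (g : Module.End ℂ V) x = 0 := by
      apply hnd
      intro z
      have hz : (g : Module.End ℂ V) ((↑g⁻¹ : Module.End ℂ V) z) = z := by
        rw [← Module.End.mul_apply, Units.mul_inv, Module.End.one_apply]
      rw [← hz, ← hsw, ← Module.End.mul_apply, hx, map_zero, LinearMap.zero_apply]
    have : x = 0 := by
      rw [← Module.End.one_apply (R := ℂ) x, ← Units.inv_mul g, Module.End.mul_apply, hgx,
        map_zero]
    rw [this, map_zero, LinearMap.zero_apply]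
  have hunit : IsUnit (adj g * (g : Module.End ℂ V)) :=
    (Module.End.isUnit_iff _).2 ⟨hinj, LinearMap.injective_iff_surjective.1 hinj⟩
  obtain ⟨s, hs, hss⟩ := exists_mul_self_eq_of_mem_adjoin hunit
  have hsu : IsUnit s := by
    rw [← hss, ← sq] at hunit
    exact (isUnit_pow_iff two_ne_zero).1 hunit
  obtain ⟨u, rfl⟩ := hsu
  have huH : u ∈ H := hH g hg u hs
  have husa : ∀ x y, ω ((u : Module.End ℂ V) x) y = ω x ((u : Module.End ℂ V) y) :=
    selfAdjoint_of_mem_adjoin hs fun x y => by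
      rw [Module.End.mul_apply, hsw, hadj, Module.End.mul_apply]
  have huF : ∀ k, Submodule.map (u : Module.End ℂ V) (F k) = F k := by
    intro k
    apply Submodule.eq_of_le_of_finrank_eq
    · rintro _ ⟨x, hx, rfl⟩
      exact apply_mem_of_mem_adjoin hs (fun x hx => hadjF k _ (hmapg k x hx)) x hx
    · exact (Submodule.equivMapOfInjective _
        ((Module.End.isUnit_iff _).1 u.isUnit).1 (F k)).finrank_eq.symm
  have hui : ∀ x, (u : Module.End ℂ V) ((↑u⁻¹ : Module.End ℂ V) x) = x := fun x => by
    rw [← Module.End.mul_apply, Units.mul_inv, Module.End.one_apply]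
  refine ⟨g * u⁻¹, H.mul_mem hg (H.inv_mem huH), fun x y => ?_, fun k => ?_⟩
  · rw [Units.val_mul, Module.End.mul_apply, Module.End.mul_apply, hadj,
      ← Module.End.mul_apply (adj g), ← hss, Module.End.mul_apply, ← husa, hui, hui]
  · conv_lhs => rw [← huF k]
    rw [← hgF k, ← Submodule.map_comp]
    congr 1
    rw [← Module.End.mul_eq_comp, ← Units.val_mul, inv_mul_cancel_right]
end
end

section
/- Let V be a finite-dimensional complex vector space endowed with a nondegenerate symmetric or symplectic bilinear form ω, and let V = V_+ ⊕ V_− be a direct sum decomposition such that either (V_+^⊥, V_−^⊥) = (V_+, V_−) or (V_+^⊥, V_−^⊥) = (V_−, V_+). Then the subgroup H = {g ∈ GL(V) : g(V_+) = V_+ and g(V_−) = V_−} satisfies: for every g ∈ H, every invertible element of the unital subalgebra ℂ[g*g] of End(V) generated by g*g belongs to H (where f* denotes the adjoint of f with respect to ω). -/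
noncomputable section

/-- If `ω` is reflexive and `f` maps `W` into itself, an adjoint of `f` maps `W^⊥` into itself. -/
theorem adjoint_mem_perpB {V : Type*} [AddCommGroup V] [Module ℂ V]
    {ω : V →ₗ[ℂ] V →ₗ[ℂ] ℂ} (hrefl : ∀ x y : V, ω x y = 0 → ω y x = 0)
    {f f' : Module.End ℂ V} (hadj : ∀ x y : V, ω (f x) y = ω x (f' y))
    {W : Submodule ℂ V} (hW : ∀ x ∈ W, f x ∈ W) {x : V} (hx : x ∈ perpB ω W) :
    f' x ∈ perpB ω W := by
  intro y hy
  apply hrefl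
  rw [← hadj]
  exact hrefl _ _ (hx _ (hW y hy))

/-- A subspace stable under `f` is stable under the unital subalgebra generated by `f`. -/
theorem apply_mem_of_mem_adjoin_singleton {R M : Type*} [CommSemiring R] [AddCommMonoid M]
    [Module R M] {f u : Module.End R M} (hu : u ∈ Algebra.adjoin R {f}) {W : Submodule R M}
    (hW : ∀ x ∈ W, f x ∈ W) : ∀ x ∈ W, u x ∈ W := by
  induction hu using Algebra.adjoin_induction with
  | mem a ha => rwa [Set.mem_singleton_iff.mp ha]
  | algebraMap r => exact fun x hx => W.smul_mem r hx
  | add a b _ _ ha hb => exact fun x hx => W.add_mem (ha x hx) (hb x hx)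
  | mul a b _ _ ha hb => exact fun x hx => ha _ (hb x hx)

/-- A finite-dimensional subspace mapped into itself by an invertible endomorphism is mapped
onto itself. -/
theorem map_units_eq_of_forall_mem {K V : Type*} [Field K] [AddCommGroup V] [Module K V]
    (u : (Module.End K V)ˣ) {W : Submodule K V} [FiniteDimensional K W]
    (hW : ∀ x ∈ W, (u : Module.End K V) x ∈ W) :
    Submodule.map (u : Module.End K V) W = W :=
  Submodule.eq_of_le_of_finrank_eq (Submodule.map_le_iff_le_comap.mpr hW)
    (LinearEquiv.finrank_map_eq (LinearMap.GeneralLinearGroup.generalLinearEquiv K V u) W)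

/-- Let `V` be a finite-dimensional complex vector space with a nondegenerate
symmetric or symplectic bilinear form `ω`, and let `V = V₊ ⊕ V₋` be a decomposition with
`(V₊^⊥, V₋^⊥) = (V₊, V₋)` or `(V₋, V₊)`.  Then the subgroup
`H = {g ∈ GL(V) : g(V₊) = V₊, g(V₋) = V₋}` satisfies: for every `g ∈ H`, every invertible
element of the unital subalgebra `ℂ[g*g]` generated by `g* g` belongs to `H`. -/
theorem stmt_1 {V : Type*} [AddCommGroup V] [Module ℂ V] [FiniteDimensional ℂ V]
    (ω : V →ₗ[ℂ] V →ₗ[ℂ] ℂ)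
    (hnd : ∀ x : V, (∀ y : V, ω x y = 0) → x = 0)
    (hsymp : (∀ x y : V, ω x y = ω y x) ∨ (∀ x y : V, ω x y = - ω y x))
    (adj : Module.End ℂ V → Module.End ℂ V)
    (hadj : ∀ (f : Module.End ℂ V) (x y : V), ω (f x) y = ω x (adj f y))
    (Vp Vm : Submodule ℂ V) (hdec : IsCompl Vp Vm)
    (hperp : (perpB ω Vp = Vp ∧ perpB ω Vm = Vm) ∨ (perpB ω Vp = Vm ∧ perpB ω Vm = Vp))
    (g : (Module.End ℂ V)ˣ)
    (hg : Submodule.map (g : Module.End ℂ V) Vp = Vp ∧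
          Submodule.map (g : Module.End ℂ V) Vm = Vm)
    (u : (Module.End ℂ V)ˣ)
    (hu : (u : Module.End ℂ V) ∈
      Algebra.adjoin ℂ {adj (g : Module.End ℂ V) * (g : Module.End ℂ V)}) :
    Submodule.map (u : Module.End ℂ V) Vp = Vp ∧
      Submodule.map (u : Module.End ℂ V) Vm = Vm := by
  have hrefl : ∀ x y : V, ω x y = 0 → ω y x = 0 := by
    intro x y h
    rcases hsymp with hs | hs
    · rw [hs, h]
    · rw [hs, h, neg_zero]
  have hgp : ∀ x ∈ Vp, (g : Module.End ℂ V) x ∈ Vp :=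
    fun x hx => hg.1.le (Submodule.mem_map_of_mem hx)
  have hgm : ∀ x ∈ Vm, (g : Module.End ℂ V) x ∈ Vm :=
    fun x hx => hg.2.le (Submodule.mem_map_of_mem hx)
  have hp : ∀ x ∈ perpB ω Vp, adj (g : Module.End ℂ V) x ∈ perpB ω Vp :=
    fun x hx => adjoint_mem_perpB hrefl (hadj g) hgp hx
  have hm : ∀ x ∈ perpB ω Vm, adj (g : Module.End ℂ V) x ∈ perpB ω Vm :=
    fun x hx => adjoint_mem_perpB hrefl (hadj g) hgm hx
  have hstable : (∀ x ∈ Vp, adj (g : Module.End ℂ V) x ∈ Vp) ∧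
      ∀ x ∈ Vm, adj (g : Module.End ℂ V) x ∈ Vm := by
    rcases hperp with ⟨h₁, h₂⟩ | ⟨h₁, h₂⟩
    · rw [h₁] at hp
      rw [h₂] at hm
      exact ⟨hp, hm⟩
    · rw [h₁] at hp
      rw [h₂] at hm
      exact ⟨hm, hp⟩
  exact ⟨map_units_eq_of_forall_mem u (apply_mem_of_mem_adjoin_singleton hu
      fun x hx => hstable.1 _ (hgp x hx)),
    map_units_eq_of_forall_mem u (apply_mem_of_mem_adjoin_singleton hu
      fun x hx => hstable.2 _ (hgm x hx))⟩
end
end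

section
/- For every w ∈ 𝕀_∞^ε(ι), the intersection 𝓞_w ∩ 𝕺_w equals {F_σ(v) : v is an admissible basis of V that is simultaneously w-dual and w-conjugate}, and this set is nonempty. -/
noncomputable section

/-- The standard basis vector `e_ℓ` of `V = ℕ →₀ ℂ`. -/
def eB (ℓ : ℕ) : ℕ →₀ ℂ := Finsupp.single ℓ 1

/-- The bilinear form `ω(x,y) = xᵀ Ω y` on `V = ℕ →₀ ℂ`, where `Ω` is the block
diagonal matrix encoded by the involution `ι` pairing adjacent indices:
`Ω i j = 0` unless `j = ι i`, and `Ω i (ι i) = 1` if `i ≤ ι i`, `= ε` if `ι i < i`. -/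
def omegaInf (ε : ℂ) (ι : ℕ → ℕ) (x y : ℕ →₀ ℂ) : ℂ :=
  x.sum fun i xi => xi * ((if i ≤ ι i then (1 : ℂ) else ε) * y (ι i))

/-- The antilinear map `γ(x) = Ω · x̄` on `V = ℕ →₀ ℂ`. -/
def gammaInf (ε : ℂ) (ι : ℕ → ℕ) (x : ℕ →₀ ℂ) : ℕ →₀ ℂ :=
  x.sum fun i xi => Finsupp.single (ι i) ((if ι i ≤ i then (1 : ℂ) else ε) * star xi)

/-- An admissible basis of `V`: a basis `v` with `v ℓ = e_ℓ` for all but finitely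
many `ℓ`. -/
def IsAdmBasis (v : ℕ → ℕ →₀ ℂ) : Prop :=
  LinearIndependent ℂ v ∧ Submodule.span ℂ (Set.range v) = ⊤ ∧
    {ℓ : ℕ | v ℓ ≠ eB ℓ}.Finite

/-- The maximal generalized flag `F_σ(v)`, viewed as the collection of its subspaces
`F'_a = span{v_ℓ : σ ℓ < a}` and `F''_a = span{v_ℓ : σ ℓ ≤ a}` for `a ∈ A`. -/
def flagSet {A : Type*} [LinearOrder A] (σ : ℕ → A) (v : ℕ → ℕ →₀ ℂ) :
    Set (Submodule ℂ (ℕ →₀ ℂ)) :=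
  {W | (∃ a : A, W = Submodule.span ℂ {x | ∃ ℓ, σ ℓ < a ∧ x = v ℓ}) ∨
       (∃ a : A, W = Submodule.span ℂ {x | ∃ ℓ, σ ℓ ≤ a ∧ x = v ℓ})}

/-- `v` is a `w`-dual admissible basis: `ω(v_ℓ, v_k) = 0` if `ℓ ≠ w k`, and
`ω(v_ℓ, v_k) = ±1` if `ℓ = w k`. -/
def IsWDualInf (ε : ℂ) (ι : ℕ → ℕ) (w : ℕ → ℕ) (v : ℕ → ℕ →₀ ℂ) : Prop :=
  ∀ k l : ℕ, (l ≠ w k → omegaInf ε ι (v l) (v k) = 0) ∧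
    (l = w k → omegaInf ε ι (v l) (v k) = 1 ∨ omegaInf ε ι (v l) (v k) = -1)

/-- `v` is a `w`-conjugate admissible basis: `γ(v_k) = ± v_{w k}` for all `k`. -/
def IsWConjInf (ε : ℂ) (ι : ℕ → ℕ) (w : ℕ → ℕ) (v : ℕ → ℕ →₀ ℂ) : Prop :=
  ∀ k : ℕ, gammaInf ε ι (v k) = v (w k) ∨ gammaInf ε ι (v k) = -(v (w k))

/-- `w ∈ 𝕀_∞^ε(ι)`: `w` is an involution of `ℕ` with `w ℓ = ι ℓ` for all but finitely
many `ℓ`, and without fixed points in type A2 (`ε = -1`). -/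
def InIinf (ε : ℂ) (ι : ℕ → ℕ) (w : ℕ → ℕ) : Prop :=
  (∀ k, w (w k) = k) ∧ {ℓ : ℕ | w ℓ ≠ ι ℓ}.Finite ∧ (ε = -1 → ∀ k, w k ≠ k)

/-- `𝓞_w`: the set of generalized flags arising from admissible `w`-dual bases. -/
def OsetInf {A : Type*} [LinearOrder A] (σ : ℕ → A) (ε : ℂ) (ι : ℕ → ℕ) (w : ℕ → ℕ) :
    Set (Set (Submodule ℂ (ℕ →₀ ℂ))) :=
  {S | ∃ v, IsAdmBasis v ∧ IsWDualInf ε ι w v ∧ S = flagSet σ v}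

/-- `𝕺_w`: the set of generalized flags arising from admissible `w`-conjugate bases. -/
def OOsetInf {A : Type*} [LinearOrder A] (σ : ℕ → A) (ε : ℂ) (ι : ℕ → ℕ) (w : ℕ → ℕ) :
    Set (Set (Submodule ℂ (ℕ →₀ ℂ))) :=
  {S | ∃ v, IsAdmBasis v ∧ IsWConjInf ε ι w v ∧ S = flagSet σ v}


/-- The standard Hermitian form `x̄ᵀ y` on `ℕ →₀ ℂ`, linear in the second variable. -/
def hermForm (x : ℕ →₀ ℂ) : (ℕ →₀ ℂ) →ₗ[ℂ] ℂ where
  toFun y := x.sum fun i xi => star xi * y i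
  map_add' y z := by simp [Finsupp.sum, mul_add, Finset.sum_add_distrib]
  map_smul' c y := by
    simp only [Finsupp.sum, Finset.mul_sum, Finsupp.smul_apply, smul_eq_mul, RingHom.id_apply]
    exact Finset.sum_congr rfl fun _ _ => by ring

lemma hermForm_single (i : ℕ) (a : ℂ) (y : ℕ →₀ ℂ) :
    hermForm (Finsupp.single i a) y = star a * y i := by
  simp [hermForm]

lemma hermForm_zero_left (y : ℕ →₀ ℂ) : hermForm 0 y = 0 := by
  simp [hermForm]

lemma hermForm_add_left (x x' y : ℕ →₀ ℂ) :
    hermForm (x + x') y = hermForm x y + hermForm x' y :=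
  Finsupp.sum_add_index' (h := fun i xi => star xi * y i) (by simp) (by intros; simp [add_mul])

lemma hermForm_smul_left (c : ℂ) (x y : ℕ →₀ ℂ) :
    hermForm (c • x) y = star c * hermForm x y := by
  induction x using Finsupp.induction_linear with
  | zero => simp [hermForm_zero_left]
  | add f g hf hg => rw [smul_add, hermForm_add_left, hermForm_add_left, hf, hg, mul_add]
  | single i a =>
    rw [Finsupp.smul_single, hermForm_single, hermForm_single, smul_eq_mul, star_mul', mul_assoc]

lemma hermForm_conj_symm (x y : ℕ →₀ ℂ) : hermForm x y = star (hermForm y x) := by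
  induction x using Finsupp.induction_linear with
  | zero => simp [hermForm_zero_left]
  | add f g hf hg => rw [map_add, hermForm_add_left, star_add, hf, hg]
  | single i a =>
    induction y using Finsupp.induction_linear with
    | zero => simp [hermForm_zero_left]
    | add f g hf hg => rw [map_add, hermForm_add_left, star_add, hf, hg]
    | single j b =>
      by_cases h : i = j
      · subst h; simp [hermForm_single, mul_comm]
      · simp [hermForm_single, h, Ne.symm h]

lemma hermForm_eq_zero_symm {x y : ℕ →₀ ℂ} (h : hermForm x y = 0) : hermForm y x = 0 := by
  rw [hermForm_conj_symm, h, star_zero]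

lemma hermForm_self (x : ℕ →₀ ℂ) :
    hermForm x x = ((∑ i ∈ x.support, Complex.normSq (x i) : ℝ) : ℂ) := by
  simp only [hermForm, Finsupp.sum, LinearMap.coe_mk, AddHom.coe_mk, Complex.ofReal_sum]
  exact Finset.sum_congr rfl fun i _ => by simp [Complex.normSq_eq_conj_mul_self]

lemma eq_zero_of_hermForm_self {x : ℕ →₀ ℂ} (h : hermForm x x = 0) : x = 0 := by
  rw [hermForm_self, Complex.ofReal_eq_zero,
    Finset.sum_eq_zero_iff_of_nonneg fun _ _ => Complex.normSq_nonneg _] at h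
  ext i
  by_cases hi : i ∈ x.support
  · simpa using h i hi
  · simpa using hi

lemma exists_smul_hermForm_self_eq_one {x : ℕ →₀ ℂ} (h : x ≠ 0) :
    ∃ c : ℂ, c ≠ 0 ∧ hermForm (c • x) (c • x) = 1 := by
  set r : ℝ := ∑ i ∈ x.support, Complex.normSq (x i) with hr
  have hx : hermForm x x = (r : ℂ) := hermForm_self x
  have hr0 : 0 ≤ r := Finset.sum_nonneg fun _ _ => Complex.normSq_nonneg _
  have hr1 : r ≠ 0 := fun h0 => h (eq_zero_of_hermForm_self (by rw [hx, h0]; simp))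
  have hs : √r ≠ 0 := (Real.sqrt_ne_zero hr0).2 hr1
  refine ⟨((√r)⁻¹ : ℝ), by exact_mod_cast inv_ne_zero hs, ?_⟩
  rw [hermForm_smul_left, map_smul, hx, smul_eq_mul, Complex.star_def, Complex.conj_ofReal]
  norm_cast
  rw [← mul_assoc, ← mul_inv, Real.mul_self_sqrt hr0, inv_mul_cancel₀ hr1]

lemma gammaInf_single (ε : ℂ) (ι : ℕ → ℕ) (i : ℕ) (a : ℂ) :
    gammaInf ε ι (Finsupp.single i a) =
      Finsupp.single (ι i) ((if ι i ≤ i then (1 : ℂ) else ε) * star a) := by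
  simp [gammaInf]

lemma gammaInf_zero (ε : ℂ) (ι : ℕ → ℕ) : gammaInf ε ι 0 = 0 := by
  simp [gammaInf]

lemma gammaInf_add (ε : ℂ) (ι : ℕ → ℕ) (x y : ℕ →₀ ℂ) :
    gammaInf ε ι (x + y) = gammaInf ε ι x + gammaInf ε ι y :=
  Finsupp.sum_add_index' (by simp) (by intros; simp [mul_add])

lemma gammaInf_smul (ε : ℂ) (ι : ℕ → ℕ) (c : ℂ) (x : ℕ →₀ ℂ) :
    gammaInf ε ι (c • x) = star c • gammaInf ε ι x := by
  induction x using Finsupp.induction_linear with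
  | zero => simp [gammaInf_zero]
  | add f g hf hg => rw [smul_add, gammaInf_add, gammaInf_add, hf, hg, smul_add]
  | single i a =>
    rw [Finsupp.smul_single, gammaInf_single, gammaInf_single, Finsupp.smul_single]
    congr 1
    rw [smul_eq_mul, star_mul', smul_eq_mul]; ring

lemma omegaInf_add_left (ε : ℂ) (ι : ℕ → ℕ) (x x' y : ℕ →₀ ℂ) :
    omegaInf ε ι (x + x') y = omegaInf ε ι x y + omegaInf ε ι x' y :=
  Finsupp.sum_add_index' (by simp) (by intros; ring)

lemma omegaInf_single (ε : ℂ) (ι : ℕ → ℕ) (i : ℕ) (a : ℂ) (y : ℕ →₀ ℂ) :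
    omegaInf ε ι (Finsupp.single i a) y = a * ((if i ≤ ι i then (1 : ℂ) else ε) * y (ι i)) := by
  simp [omegaInf]

lemma omegaInf_smul_left (ε : ℂ) (ι : ℕ → ℕ) (c : ℂ) (x y : ℕ →₀ ℂ) :
    omegaInf ε ι (c • x) y = c * omegaInf ε ι x y := by
  induction x using Finsupp.induction_linear with
  | zero => simp [omegaInf]
  | add f g hf hg => rw [smul_add, omegaInf_add_left, omegaInf_add_left, hf, hg, mul_add]
  | single i a =>
    rw [Finsupp.smul_single, omegaInf_single, omegaInf_single, smul_eq_mul, mul_assoc]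

lemma omegaInf_gammaInf {ε : ℂ} {ι : ℕ → ℕ} (hι : ∀ ℓ, ι (ι ℓ) = ℓ) (hε : ε * ε = 1)
    (x y : ℕ →₀ ℂ) : omegaInf ε ι (gammaInf ε ι x) y = hermForm x y := by
  induction x using Finsupp.induction_linear with
  | zero => simp [gammaInf, omegaInf, hermForm]
  | add f g hf hg => rw [gammaInf_add, omegaInf_add_left, hermForm_add_left, hf, hg]
  | single i a =>
    rw [gammaInf_single, omegaInf_single, hermForm_single, hι]
    split_ifs
    · ring
    · linear_combination (star a * y i) * hε

lemma gammaInf_gammaInf {ε : ℂ} {ι : ℕ → ℕ} (hι : ∀ ℓ, ι (ι ℓ) = ℓ)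
    (htype : ε = 1 ∨ (ε = -1 ∧ ∀ ℓ, ι ℓ ≠ ℓ)) (x : ℕ →₀ ℂ) :
    gammaInf ε ι (gammaInf ε ι x) = ε • x := by
  induction x using Finsupp.induction_linear with
  | zero => simp [gammaInf_zero]
  | add f g hf hg => rw [gammaInf_add, gammaInf_add, hf, hg, smul_add]
  | single i a =>
    rw [gammaInf_single, gammaInf_single, hι, Finsupp.smul_single]
    congr 1
    rcases htype with rfl | ⟨rfl, h⟩
    · simp
    · rcases lt_or_gt_of_ne (h i) with h' | h'
      · simp [h'.le, h'.not_ge]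
      · simp [h'.le, h'.not_ge]

lemma mul_self_of_type {ε : ℂ} {ι : ℕ → ℕ} (htype : ε = 1 ∨ (ε = -1 ∧ ∀ ℓ, ι ℓ ≠ ℓ)) :
    ε * ε = 1 := by
  rcases htype with rfl | ⟨rfl, -⟩ <;> norm_num

lemma hermForm_gammaInf_left {ε : ℂ} {ι : ℕ → ℕ} (hι : ∀ ℓ, ι (ι ℓ) = ℓ)
    (htype : ε = 1 ∨ (ε = -1 ∧ ∀ ℓ, ι ℓ ≠ ℓ)) (x y : ℕ →₀ ℂ) :
    hermForm (gammaInf ε ι x) y = ε * omegaInf ε ι x y := by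
  rw [← omegaInf_gammaInf hι (mul_self_of_type htype), gammaInf_gammaInf hι htype,
    omegaInf_smul_left]

lemma hermForm_gammaInf_gammaInf {ε : ℂ} {ι : ℕ → ℕ} (hι : ∀ ℓ, ι (ι ℓ) = ℓ)
    (htype : ε = 1 ∨ (ε = -1 ∧ ∀ ℓ, ι ℓ ≠ ℓ)) (x y : ℕ →₀ ℂ) :
    hermForm (gammaInf ε ι x) (gammaInf ε ι y) = hermForm y x := by
  induction x using Finsupp.induction_linear with
  | zero => simp [gammaInf_zero, hermForm_zero_left]
  | add f g hf hg => rw [gammaInf_add, hermForm_add_left, hf, hg, map_add]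
  | single i a =>
    induction y using Finsupp.induction_linear with
    | zero => simp [gammaInf_zero, hermForm_zero_left]
    | add f g hf hg => rw [gammaInf_add, hermForm_add_left, map_add, hf, hg]
    | single j b =>
      rw [gammaInf_single, gammaInf_single, hermForm_single, hermForm_single]
      by_cases h : i = j
      · subst h
        have h1 := mul_self_of_type htype
        have h2 : star ε = ε := by rcases htype with rfl | ⟨rfl, -⟩ <;> simp
        simp only [Finsupp.single_eq_same, star_mul', star_star]
        split_ifs
        · simp [mul_comm]
        · rw [h2]; linear_combination (a * star b) * h1
      · have h' : ι j ≠ ι i := fun e => h (by rw [← hι i, ← e, hι])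
        simp [h, h']

/-- Orthonormality of a family of vectors for `hermForm`. -/
def IsHermOrthonormal (x : ℕ → ℕ →₀ ℂ) : Prop :=
  ∀ i j, hermForm (x i) (x j) = if i = j then 1 else 0

lemma IsHermOrthonormal.linearIndependent {x : ℕ → ℕ →₀ ℂ} (hx : IsHermOrthonormal x) :
    LinearIndependent ℂ x := by
  rw [linearIndependent_iff']
  intro s g hg i hi
  have h := congrArg (hermForm (x i)) hg
  simpa [map_sum, hx i, hi] using h

lemma IsHermOrthonormal.isWDualInf {ε : ℂ} {ι w : ℕ → ℕ} (hι : ∀ ℓ, ι (ι ℓ) = ℓ)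
    (htype : ε = 1 ∨ (ε = -1 ∧ ∀ ℓ, ι ℓ ≠ ℓ)) (hw : ∀ k, w (w k) = k) {y : ℕ → ℕ →₀ ℂ}
    (hy : IsHermOrthonormal y) (hc : IsWConjInf ε ι w y) : IsWDualInf ε ι w y := by
  intro k l
  have h1 := hermForm_gammaInf_left hι htype (y l) (y k)
  have h2 : hermForm (gammaInf ε ι (y l)) (y k) = (if w l = k then 1 else 0) ∨
      hermForm (gammaInf ε ι (y l)) (y k) = -(if w l = k then 1 else 0) := by
    rcases hc l with h | h
    · left; rw [h, hy]
    · right; rw [h, ← neg_one_smul ℂ, hermForm_smul_left, hy, star_neg, star_one, neg_one_mul]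
  have h3 : omegaInf ε ι (y l) (y k) = ε * hermForm (gammaInf ε ι (y l)) (y k) := by
    rw [h1, ← mul_assoc, mul_self_of_type htype, one_mul]
  constructor
  · intro hl
    have : w l ≠ k := fun e => hl (by rw [← e, hw])
    rw [h3]
    rcases h2 with h | h <;> simp [h, this]
  · rintro rfl
    rw [h3]
    rcases htype with rfl | ⟨rfl, -⟩ <;> rcases h2 with h | h <;> simp [h, hw]

/-- The family obtained from `y` by mixing `y k` with `y (t k)`, for an involution `t`. -/
def mixFamily (a : ℂ) (t : ℕ → ℕ) (y : ℕ → ℕ →₀ ℂ) (k : ℕ) : ℕ →₀ ℂ :=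
  a • y k + star a • y (t k)

section mixFamily

variable {a : ℂ} {t : ℕ → ℕ} {y : ℕ → ℕ →₀ ℂ}

lemma IsHermOrthonormal.mixFamily (ht : ∀ k, t (t k) = k) (h1 : a * a + star a * star a = 0)
    (h2 : a * star a = 1 / 2) (hy : IsHermOrthonormal y) :
    IsHermOrthonormal (mixFamily a t y) := by
  intro i j
  simp only [_root_.mixFamily, hermForm_add_left, hermForm_smul_left, map_add, map_smul, hy _ _,
    smul_eq_mul, star_star]
  have e1 : t i = t j ↔ i = j := ⟨fun e => by rw [← ht i, e, ht], fun e => by rw [e]⟩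
  have e2 : t i = j ↔ i = t j := ⟨fun e => by rw [← e, ht], fun e => by rw [e, ht]⟩
  simp only [e1, e2]
  split_ifs
  · linear_combination 2 * h2 + h1
  · linear_combination 2 * h2
  · linear_combination h1
  · ring

lemma mixFamily_star_mixFamily (ht : ∀ k, t (t k) = k) (h1 : a * a + star a * star a = 0)
    (h2 : a * star a = 1 / 2) (k : ℕ) : mixFamily (star a) t (mixFamily a t y) k = y k := by
  simp only [mixFamily, ht, star_star]
  match_scalars
  · linear_combination 2 * h2
  · linear_combination h1

lemma mixFamily_mem_span (a : ℂ) (t : ℕ → ℕ) (y : ℕ → ℕ →₀ ℂ) (k : ℕ) :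
    mixFamily a t y k ∈ Submodule.span ℂ (Set.range y) :=
  add_mem (Submodule.smul_mem _ _ (Submodule.subset_span ⟨_, rfl⟩))
    (Submodule.smul_mem _ _ (Submodule.subset_span ⟨_, rfl⟩))

lemma span_range_mixFamily (ht : ∀ k, t (t k) = k) (h1 : a * a + star a * star a = 0)
    (h2 : a * star a = 1 / 2) (hy : Submodule.span ℂ (Set.range y) = ⊤) :
    Submodule.span ℂ (Set.range (mixFamily a t y)) = ⊤ := by
  rw [eq_top_iff, ← hy, Submodule.span_le]
  rintro _ ⟨k, rfl⟩
  rw [← mixFamily_star_mixFamily (y := y) ht h1 h2 k]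
  exact mixFamily_mem_span _ _ _ _

lemma gammaInf_mixFamily_of_fixed {ε : ℂ} {ι : ℕ → ℕ} (ht : ∀ k, t (t k) = k)
    (hy : ∀ k, gammaInf ε ι (y k) = y k) (k : ℕ) :
    gammaInf ε ι (mixFamily a t y k) = mixFamily a t y (t k) := by
  simp only [mixFamily, gammaInf_add, gammaInf_smul, hy, ht, star_star, add_comm]

lemma gammaInf_mixFamily_of_swap {ε : ℂ} {ι : ℕ → ℕ} (ht : ∀ k, t (t k) = k)
    (hy : ∀ k, gammaInf ε ι (y k) = y (t k)) (k : ℕ) :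
    gammaInf ε ι (mixFamily a t y k) = mixFamily a t y k := by
  simp only [mixFamily, gammaInf_add, gammaInf_smul, hy, ht, star_star, add_comm]

end mixFamily

lemma isHermOrthonormal_eB : IsHermOrthonormal eB := by
  intro i j
  simp [eB, hermForm_single, Finsupp.single_apply, eq_comm]

lemma span_range_eB : Submodule.span ℂ (Set.range eB) = ⊤ := by
  rw [← (Finsupp.basisSingleOne (R := ℂ) (ι := ℕ)).span_eq, Finsupp.coe_basisSingleOne]
  rfl

lemma gammaInf_eB (ε : ℂ) (ι : ℕ → ℕ) (k : ℕ) :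
    gammaInf ε ι (eB k) = (if ι k ≤ k then (1 : ℂ) else ε) • eB (ι k) := by
  rw [eB, gammaInf_single, eB, Finsupp.smul_single, star_one, smul_eq_mul]

lemma exists_adapted_basis_of_eq_one {ι w : ℕ → ℕ} (hι : ∀ ℓ, ι (ι ℓ) = ℓ)
    (hw : ∀ k, w (w k) = k) (hfin : {ℓ : ℕ | w ℓ ≠ ι ℓ}.Finite) :
    ∃ y, IsAdmBasis y ∧ IsHermOrthonormal y ∧ IsWConjInf 1 ι w y := by
  obtain ⟨a, h1, h2⟩ : ∃ a : ℂ, a * a + star a * star a = 0 ∧ a * star a = 1 / 2 := by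
    refine ⟨⟨1 / 2, 1 / 2⟩, ?_, ?_⟩ <;> apply Complex.ext <;> (simp; try norm_num)
  have h1' : star a * star a + star (star a) * star (star a) = 0 := by
    rw [star_star, add_comm, h1]
  have h2' : star a * star (star a) = 1 / 2 := by rw [star_star, mul_comm, h2]
  set f := mixFamily a ι eB with hf
  have hg : ∀ k, gammaInf 1 ι (f k) = f k :=
    gammaInf_mixFamily_of_swap hι fun k => by simp [gammaInf_eB]
  have ho := (isHermOrthonormal_eB.mixFamily hι h1 h2).mixFamily hw h1' h2'
  refine ⟨mixFamily (star a) w f, ⟨ho.linearIndependent, ?_, ?_⟩, ho, fun k => .inl ?_⟩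
  · exact span_range_mixFamily hw h1' h2' (span_range_mixFamily hι h1 h2 span_range_eB)
  · refine hfin.subset fun k hk hk' => hk ?_
    rw [← mixFamily_star_mixFamily (y := eB) hι h1 h2 k, mixFamily, hk', ← hf, mixFamily]
  · exact gammaInf_mixFamily_of_fixed hw hg k

lemma exists_perm_conj {ι : ℕ → ℕ} (hι : ∀ ℓ, ι (ι ℓ) = ℓ) (hι' : ∀ ℓ, ι ℓ ≠ ℓ) (n : ℕ)
    (w : ℕ → ℕ) (hw : ∀ k, w (w k) = k) (hw' : ∀ k, w k ≠ k)
    (hfin : {ℓ : ℕ | w ℓ ≠ ι ℓ}.Finite) (hn : {ℓ : ℕ | w ℓ ≠ ι ℓ}.ncard ≤ n) :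
    ∃ τ : Equiv.Perm ℕ, (∀ k, τ (w k) = ι (τ k)) ∧ {k | τ k ≠ k}.Finite := by
  induction n generalizing w with
  | zero =>
    have h0 : {ℓ : ℕ | w ℓ ≠ ι ℓ} = ∅ := (Set.ncard_eq_zero hfin).1 (by omega)
    refine ⟨1, fun k => ?_, by simp⟩
    by_contra h
    exact (h0 ▸ (show k ∈ {ℓ : ℕ | w ℓ ≠ ι ℓ} from h) : k ∈ (∅ : Set ℕ))
  | succ n ih =>
    by_cases hall : ∀ k, w k = ι k
    · exact ⟨1, hall, by simp⟩
    push Not at hall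
    obtain ⟨k, hk⟩ := hall
    set s := Equiv.swap (w k) (ι k) with hs
    have hss : ∀ j, s (s j) = j := Equiv.swap_apply_self _ _
    have hsk : s k = k := Equiv.swap_apply_of_ne_of_ne (hw' k).symm (hι' k).symm
    have hsub : {ℓ : ℕ | s (w (s ℓ)) ≠ ι ℓ} ⊆ {ℓ : ℕ | w ℓ ≠ ι ℓ} \ {k} := by
      intro j hj
      have hjk : j ≠ k := by
        rintro rfl
        exact hj (by rw [hsk, hs, Equiv.swap_apply_left])
      refine ⟨fun e => ?_, hjk⟩
      have h1 : j ≠ w k := by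
        rintro rfl
        rw [hw] at e
        exact hk (by rw [e, hι, ← e])
      have h2 : j ≠ ι k := by
        rintro rfl
        rw [hι] at e
        exact hk (by rw [← e, hw, e])
      apply hj
      rw [hs, Equiv.swap_apply_of_ne_of_ne h1 h2, Equiv.swap_apply_of_ne_of_ne, e]
      · exact fun h => hjk (by rw [← hw j, h, hw])
      · exact fun h => hjk (by rw [← hι j, ← e, h, hι])
    have hlt : {ℓ : ℕ | s (w (s ℓ)) ≠ ι ℓ}.ncard < {ℓ : ℕ | w ℓ ≠ ι ℓ}.ncard :=
      (Set.ncard_le_ncard hsub hfin.sdiff).trans_lt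
        (Set.ncard_sdiff_singleton_lt_of_mem (a := k) hk hfin)
    obtain ⟨τ, h1, h2⟩ := ih (fun j => s (w (s j))) (fun j => by simp [hss, hw])
      (fun j h => hw' (s j) (by rw [← hss (w (s j)), h])) (hfin.sdiff.subset hsub) (by omega)
    refine ⟨s.trans τ, fun j => ?_, ?_⟩
    · have := h1 (s j)
      rw [hss] at this
      exact this
    · refine (h2.union (Set.toFinite {w k, ι k})).subset fun j hj => ?_
      by_contra hj'
      simp only [Set.mem_union, Set.mem_ofPred_eq, Set.mem_insert_iff, Set.mem_singleton_iff,
        not_or, not_not] at hj'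
      refine hj ?_
      rw [Equiv.trans_apply, hs, Equiv.swap_apply_of_ne_of_ne hj'.2.1 hj'.2.2, hj'.1]

lemma exists_adapted_basis {ε : ℂ} {ι w : ℕ → ℕ} (hι : ∀ ℓ, ι (ι ℓ) = ℓ)
    (htype : ε = 1 ∨ (ε = -1 ∧ ∀ ℓ, ι ℓ ≠ ℓ)) (hw : InIinf ε ι w) :
    ∃ y, IsAdmBasis y ∧ IsHermOrthonormal y ∧ IsWConjInf ε ι w y := by
  obtain ⟨hw1, hw2, hw3⟩ := hw
  rcases htype with rfl | ⟨rfl, hι'⟩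
  · exact exists_adapted_basis_of_eq_one hι hw1 hw2
  obtain ⟨τ, h1, h2⟩ := exists_perm_conj hι hι' _ w hw1 (hw3 rfl) hw2 le_rfl
  have ho : IsHermOrthonormal fun k => eB (τ k) := fun i j => by
    simp [isHermOrthonormal_eB _ _]
  refine ⟨fun k => eB (τ k), ⟨ho.linearIndependent, ?_, ?_⟩, ho, fun k => ?_⟩
  · rw [← span_range_eB, ← τ.surjective.range_comp eB]
    rfl
  · exact h2.subset fun k hk e => hk (congrArg eB e)
  · simp only [gammaInf_eB, h1]
    split_ifs <;> simp

/-- The span of the vectors of `v` with index in `D`. -/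
def spanOn (v : ℕ → ℕ →₀ ℂ) (D : Set ℕ) : Submodule ℂ (ℕ →₀ ℂ) :=
  Submodule.span ℂ (v '' D)

section spanOn

variable {v x u : ℕ → ℕ →₀ ℂ} {D D' S : Set ℕ}

lemma mem_spanOn {k : ℕ} (hk : k ∈ D) : v k ∈ spanOn v D :=
  Submodule.subset_span (Set.mem_image_of_mem v hk)

lemma spanOn_mono (h : D ⊆ D') : spanOn v D ≤ spanOn v D' :=
  Submodule.span_mono (Set.image_mono h)

lemma spanOn_le {W : Submodule ℂ (ℕ →₀ ℂ)} (h : ∀ k ∈ D, v k ∈ W) : spanOn v D ≤ W := by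
  rw [spanOn, Submodule.span_le]
  rintro _ ⟨k, hk, rfl⟩
  exact h k hk

lemma hermForm_eq_zero_of_mem_spanOn {z y : ℕ →₀ ℂ} (h : ∀ k ∈ D, hermForm z (v k) = 0)
    (hy : y ∈ spanOn v D) : hermForm z y = 0 :=
  spanOn_le (W := LinearMap.ker (hermForm z)) (fun k hk => h k hk) hy

lemma exists_sub_smul_mem_spanOn {A : Type*} [LinearOrder A] {σ : ℕ → A}
    (hσ : Function.Injective σ) {k : ℕ} {y : ℕ →₀ ℂ} (hy : y ∈ spanOn v {j | σ j ≤ σ k}) :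
    ∃ c : ℂ, ∃ z ∈ spanOn v {j | σ j < σ k}, y = c • v k + z := by
  have h : {j | σ j ≤ σ k} = insert k {j | σ j < σ k} := by
    ext j
    simp [le_iff_eq_or_lt, hσ.eq_iff]
  rw [spanOn, h, Set.image_insert_eq, Submodule.mem_span_insert] at hy
  exact hy

/-- `v` agrees with the standard basis off `S` and is supported in `S` on `S`. -/
def IsSupportedOn (S : Set ℕ) (v : ℕ → ℕ →₀ ℂ) : Prop :=
  (∀ k ∉ S, v k = eB k) ∧ ∀ k ∈ S, ↑(v k).support ⊆ S

lemma IsSupportedOn.apply_eq_zero (hv : IsSupportedOn S v) {j k : ℕ} (hk : k ∉ S) (hjk : j ≠ k) :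
    v j k = 0 := by
  by_cases hj : j ∈ S
  · by_contra h
    exact hk (hv.2 j hj (by simpa using h))
  · rw [hv.1 j hj, eB, Finsupp.single_eq_of_ne hjk.symm]

lemma IsSupportedOn.map_restrictDom_spanOn [DecidablePred (· ∈ S)] (hv : IsSupportedOn S v)
    (D : Set ℕ) :
    (spanOn v D).map ((Finsupp.supported ℂ ℂ S).subtype ∘ₗ Finsupp.restrictDom ℂ ℂ S) =
      spanOn v (D ∩ S) := by
  have hS : ∀ k ∈ S, ((Finsupp.supported ℂ ℂ S).subtype ∘ₗ Finsupp.restrictDom ℂ ℂ S) (v k) =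
      v k := by
    intro k hk
    rw [LinearMap.comp_apply, Submodule.subtype_apply, Finsupp.restrictDom_apply,
      Finsupp.filter_eq_self_iff]
    exact fun i hi => hv.2 k hk (by simpa using hi)
  apply le_antisymm
  · rw [Submodule.map_le_iff_le_comap]
    refine spanOn_le fun k hk => ?_
    by_cases hkS : k ∈ S
    · rw [Submodule.mem_comap, hS k hkS]
      exact mem_spanOn ⟨hk, hkS⟩
    · rw [Submodule.mem_comap, LinearMap.comp_apply, Submodule.subtype_apply,
        Finsupp.restrictDom_apply, hv.1 k hkS, eB, Finsupp.filter_single_of_neg _ hkS]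
      exact zero_mem _
  · exact spanOn_le fun k hk => ⟨v k, mem_spanOn hk.1, hS k hk.2⟩

lemma finrank_spanOn (hv : LinearIndependent ℂ v) (hD : D.Finite) :
    Module.finrank ℂ (spanOn v D) = D.ncard := by
  have := hD.fintype
  rw [spanOn, Set.image_eq_range, finrank_span_eq_card (b := fun x : D => v x) (hv.comp _ Subtype.val_injective),
    Set.ncard_eq_toFinset_card', Set.toFinset_card]

/-- Families supported on a finite set with nested index sets and equal spans have equal
index sets. -/
lemma eq_of_spanOn_eq_of_subset (hS : S.Finite) (hv : IsSupportedOn S v)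
    (hu : IsSupportedOn S u) (hvi : LinearIndependent ℂ v) (hui : LinearIndependent ℂ u)
    (hDD : D ⊆ D') (h : spanOn v D = spanOn u D') : D = D' := by
  classical
  have hDS : D ∩ S = D' ∩ S := by
    apply Set.eq_of_subset_of_ncard_le (Set.inter_subset_inter_left S hDD) _
      (hS.inter_of_right D')
    rw [← finrank_spanOn hui (hS.inter_of_right D'), ← finrank_spanOn hvi (hS.inter_of_right D),
      ← hu.map_restrictDom_spanOn, ← hv.map_restrictDom_spanOn, h]
  refine hDD.antisymm fun k hk => ?_
  by_cases hkS : k ∈ S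
  · exact (hDS ▸ (⟨hk, hkS⟩ : k ∈ D' ∩ S) : k ∈ D ∩ S).1
  · by_contra hkD
    have h1 : spanOn v D ≤ LinearMap.ker (Finsupp.lapply k) :=
      spanOn_le fun j hj => hv.apply_eq_zero hkS fun e => hkD (e ▸ hj)
    have h2 : eB k ∈ spanOn v D := by
      rw [h, ← hu.1 k hkS]
      exact mem_spanOn hk
    simpa [eB] using h1 h2

end spanOn

lemma flagSet_eq {A : Type*} [LinearOrder A] (σ : ℕ → A) (v : ℕ → ℕ →₀ ℂ) :
    flagSet σ v = {W | (∃ a, W = spanOn v {j | σ j < a}) ∨ ∃ a, W = spanOn v {j | σ j ≤ a}} := by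
  have h (D : Set ℕ) : {x | ∃ ℓ, ℓ ∈ D ∧ x = v ℓ} = v '' D := by
    ext x
    simp [eq_comm]
  ext W
  simp only [flagSet, spanOn, ← h]
  rfl

lemma spanOn_eq_of_flagSet_eq {A : Type*} [LinearOrder A] {σ : ℕ → A} {S : Set ℕ}
    (hS : S.Finite) {v u : ℕ → ℕ →₀ ℂ} (hv : IsSupportedOn S v)
    (hu : IsSupportedOn S u) (hvi : LinearIndependent ℂ v) (hui : LinearIndependent ℂ u)
    (h : flagSet σ v = flagSet σ u) (a : A) :
    spanOn v {j | σ j < a} = spanOn u {j | σ j < a} ∧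
      spanOn v {j | σ j ≤ a} = spanOn u {j | σ j ≤ a} := by
  have key : ∀ D D' : Set A, IsLowerSet D → IsLowerSet D' →
      spanOn v (σ ⁻¹' D) = spanOn u (σ ⁻¹' D') → spanOn v (σ ⁻¹' D) = spanOn u (σ ⁻¹' D) := by
    intro D D' hD hD' he
    rcases hD.total hD' with hs | hs
    · rw [he, ← eq_of_spanOn_eq_of_subset hS hv hu hvi hui (Set.preimage_mono hs) he]
    · rw [he, ← eq_of_spanOn_eq_of_subset hS hu hv hui hvi (Set.preimage_mono hs) he.symm]
  rw [flagSet_eq, flagSet_eq, Set.ext_iff] at h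
  constructor
  · rcases (h _).1 (.inl ⟨a, rfl⟩) with ⟨b, hb⟩ | ⟨b, hb⟩
    · exact key (Set.Iio a) (Set.Iio b) (isLowerSet_Iio a) (isLowerSet_Iio b) hb
    · exact key (Set.Iio a) (Set.Iic b) (isLowerSet_Iio a) (isLowerSet_Iic b) hb
  · rcases (h _).1 (.inr ⟨a, rfl⟩) with ⟨b, hb⟩ | ⟨b, hb⟩
    · exact key (Set.Iic a) (Set.Iio b) (isLowerSet_Iic a) (isLowerSet_Iio b) hb
    · exact key (Set.Iic a) (Set.Iic b) (isLowerSet_Iic a) (isLowerSet_Iic b) hb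

lemma induction_off_finite {A : Type*} [LinearOrder A] (σ : ℕ → A) {S : Set ℕ} (hS : S.Finite)
    {P : ℕ → Prop} (h0 : ∀ k ∉ S, P k) (h1 : ∀ k ∈ S, (∀ j, σ j < σ k → P j) → P k) (k : ℕ) :
    P k := by
  by_contra hk
  have hne : {k | ¬ P k}.Nonempty := ⟨k, hk⟩
  have hfin : {k | ¬ P k}.Finite := hS.subset fun j hj => by_contra fun h => hj (h0 j h)
  obtain ⟨m, hm, hmin⟩ := Set.exists_min_image _ σ hfin hne
  exact hm (h1 m (by_contra fun h => hm (h0 m h)) fun j hj =>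
    by_contra fun h => (hmin j h).not_gt hj)

lemma mem_spanOn_of_triangular {A : Type*} [LinearOrder A] {σ : ℕ → A} {S : Set ℕ}
    (hS : S.Finite) {v x : ℕ → ℕ →₀ ℂ} (h0 : ∀ k ∉ S, x k = v k)
    (h1 : ∀ k, ∃ c : ℂ, c ≠ 0 ∧ ∃ z ∈ spanOn v {j | σ j < σ k}, x k = c • v k + z) (k : ℕ) :
    v k ∈ spanOn x {j | σ j ≤ σ k} := by
  induction k using induction_off_finite σ hS with
  | h0 k hk =>
    rw [← h0 k hk]
    exact mem_spanOn (D := {j | σ j ≤ σ k}) (le_refl (σ k))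
  | h1 k hk ih =>
    obtain ⟨c, hc, z, hz, hx⟩ := h1 k
    have hz' : z ∈ spanOn x {j | σ j ≤ σ k} := by
      refine spanOn_le (fun j (hj : σ j < σ k) => ?_) hz
      have hmono : {i | σ i ≤ σ j} ⊆ {i | σ i ≤ σ k} := fun i hi => le_trans hi hj.le
      exact spanOn_mono hmono (ih j hj)
    have : v k = c⁻¹ • (x k - z) := by
      rw [hx, add_sub_cancel_right, smul_smul, inv_mul_cancel₀ hc, one_smul]
    rw [this]
    exact Submodule.smul_mem _ _ (sub_mem (mem_spanOn (D := {j | σ j ≤ σ k}) (le_refl (σ k))) hz')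

lemma spanOn_eq_of_triangular {A : Type*} [LinearOrder A] {σ : ℕ → A} {S : Set ℕ}
    (hS : S.Finite) {v x : ℕ → ℕ →₀ ℂ} (h0 : ∀ k ∉ S, x k = v k)
    (h1 : ∀ k, ∃ c : ℂ, c ≠ 0 ∧ ∃ z ∈ spanOn v {j | σ j < σ k}, x k = c • v k + z)
    {D : Set ℕ} (hD : ∀ i j, σ i ≤ σ j → j ∈ D → i ∈ D) : spanOn x D = spanOn v D := by
  apply le_antisymm <;> refine spanOn_le fun k hk => ?_
  · obtain ⟨c, -, z, hz, hx⟩ := h1 k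
    rw [hx]
    exact add_mem (Submodule.smul_mem _ _ (mem_spanOn hk))
      (spanOn_mono (fun i hi => hD i k (le_of_lt hi) hk) hz)
  · exact spanOn_mono (fun i hi => hD i k hi hk) (mem_spanOn_of_triangular hS h0 h1 k)

lemma exists_orthogonal_projection (v : ℕ → ℕ →₀ ℂ) {T : Set ℕ} (hT : T.Finite) (y : ℕ →₀ ℂ) :
    ∃ p ∈ spanOn v T, ∀ j ∈ T, hermForm (v j) (y + p) = 0 := by
  induction T, hT using Set.Finite.induction_on generalizing y with
  | empty => exact ⟨0, zero_mem _, by simp⟩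
  | @insert a T ha hT ih =>
    obtain ⟨p, hp, hp'⟩ := ih y
    obtain ⟨q, hq, hq'⟩ := ih (v a)
    have hm := spanOn_mono (v := v) (Set.subset_insert a T)
    set r := v a + q with hr
    have hrm : r ∈ spanOn v (insert a T) := add_mem (mem_spanOn (Set.mem_insert a T)) (hm hq)
    have hva : ∀ z, (∀ j ∈ T, hermForm (v j) z = 0) →
        hermForm (v a) z = hermForm r z := by
      intro z hz
      have : hermForm q z = 0 := hermForm_eq_zero_symm <|
        hermForm_eq_zero_of_mem_spanOn (fun k hk => hermForm_eq_zero_symm (hz k hk)) hq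
      rw [hr, hermForm_add_left, this, add_zero]
    by_cases h0 : hermForm r r = 0
    · refine ⟨p, hm hp, ?_⟩
      rintro j (rfl | hj)
      · rw [hva _ hp', eq_zero_of_hermForm_self h0, hermForm_zero_left]
      · exact hp' j hj
    · refine ⟨p + (-(hermForm r (y + p) / hermForm r r)) • r,
        add_mem (hm hp) (Submodule.smul_mem _ _ hrm), ?_⟩
      have hT' : ∀ j ∈ T, hermForm (v j)
          (y + (p + (-(hermForm r (y + p) / hermForm r r)) • r)) = 0 := by
        intro j hj
        rw [← add_assoc, map_add, map_smul, hp' j hj, hq' j hj, smul_zero, add_zero]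
      rintro j (rfl | hj)
      · rw [hva _ hT', ← add_assoc, map_add, map_smul, smul_eq_mul]
        field_simp
        ring
      · exact hT' j hj

lemma IsSupportedOn.hermForm_eq_zero {S : Set ℕ} {v : ℕ → ℕ →₀ ℂ} (hv : IsSupportedOn S v)
    {j k : ℕ} (hk : k ∉ S) (hjk : j ≠ k) : hermForm (v k) (v j) = 0 := by
  rw [hv.1 k hk, eB, hermForm_single, hv.apply_eq_zero hk hjk, mul_zero]

/-- Gram–Schmidt orthonormalization of an admissible basis along the order given by `σ`. -/
lemma exists_gram_schmidt {A : Type*} [LinearOrder A] {σ : ℕ → A}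
    (hσ : Function.Injective σ) {S : Set ℕ} (hS : S.Finite) {v : ℕ → ℕ →₀ ℂ}
    (hv : IsSupportedOn S v) (hvi : LinearIndependent ℂ v) :
    ∃ x : ℕ → ℕ →₀ ℂ, IsHermOrthonormal x ∧ (∀ k ∉ S, x k = eB k) ∧
      ∀ k, ∃ c : ℂ, c ≠ 0 ∧ ∃ z ∈ spanOn v {j | σ j < σ k}, x k = c • v k + z := by
  have hx : ∀ k, ∃ x : ℕ →₀ ℂ, (k ∉ S → x = eB k) ∧ hermForm x x = 1 ∧
      (∀ j, σ j < σ k → hermForm (v j) x = 0) ∧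
      ∃ c : ℂ, c ≠ 0 ∧ ∃ z ∈ spanOn v {j | σ j < σ k}, x = c • v k + z := by
    intro k
    by_cases hk : k ∈ S
    · obtain ⟨p, hp, hp'⟩ := exists_orthogonal_projection v
        (hS.inter_of_left {j | σ j < σ k}) (v k)
      have hne : v k + p ≠ 0 := by
        intro h0
        have h1 := hvi.notMem_span_image (s := S ∩ {j | σ j < σ k}) (x := k) (by simp)
        exact h1 (by rw [eq_neg_of_add_eq_zero_left h0]; exact neg_mem hp)
      obtain ⟨c, hc, hc1⟩ := exists_smul_hermForm_self_eq_one hne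
      refine ⟨c • (v k + p), fun h => (h hk).elim, hc1, fun j hj => ?_, c, hc, c • p,
        Submodule.smul_mem _ _ (spanOn_mono Set.inter_subset_right hp), smul_add _ _ _⟩
      rw [map_smul]
      by_cases hjS : j ∈ S
      · rw [hp' j ⟨hjS, hj⟩, smul_zero]
      · have hkj : k ≠ j := fun h => hjS (h ▸ hk)
        rw [map_add, hv.hermForm_eq_zero hjS hkj, hermForm_eq_zero_of_mem_spanOn _ hp]
        · simp
        · intro i hi
          exact hv.hermForm_eq_zero hjS fun h => hjS (h ▸ hi.1)
    · refine ⟨eB k, fun _ => rfl, by simp [isHermOrthonormal_eB _ _], fun j hj => ?_, 1,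
        one_ne_zero, 0, zero_mem _, by simp [hv.1 k hk]⟩
      rw [← hv.1 k hk]
      exact hermForm_eq_zero_symm (hv.hermForm_eq_zero hk fun h => hj.ne (h ▸ rfl))
  choose x h0 h1 h2 h3 using hx
  have hlt : ∀ i j, σ i < σ j → hermForm (x i) (x j) = 0 := by
    intro i j hij
    obtain ⟨c, -, z, hz, hxi⟩ := h3 i
    rw [hxi, hermForm_add_left, hermForm_smul_left, h2 j i hij, mul_zero, zero_add]
    exact hermForm_eq_zero_symm (hermForm_eq_zero_of_mem_spanOn
      (fun k hk => hermForm_eq_zero_symm (h2 j k (lt_trans hk hij))) hz)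
  refine ⟨x, fun i j => ?_, h0, h3⟩
  rcases lt_trichotomy (σ i) (σ j) with h | h | h
  · rw [hlt i j h, if_neg fun e => h.ne (congrArg σ e)]
  · obtain rfl := hσ h
    rw [h1, if_pos rfl]
  · rw [hermForm_eq_zero_symm (hlt j i h), if_neg fun e => h.ne' (congrArg σ e)]

lemma eq_hermForm_smul {x : ℕ → ℕ →₀ ℂ} (hx : IsHermOrthonormal x)
    (hspan : Submodule.span ℂ (Set.range x) = ⊤) {z : ℕ →₀ ℂ} {k : ℕ}
    (h : ∀ m, m ≠ k → hermForm (x m) z = 0) : z = hermForm (x k) z • x k := by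
  set r := z - hermForm (x k) z • x k with hr
  have h1 : ∀ m, hermForm r (x m) = 0 := by
    intro m
    apply hermForm_eq_zero_symm
    rw [hr, map_sub, map_smul, hx]
    rcases eq_or_ne m k with rfl | hm
    · simp
    · simp [h m hm, hm]
  have h2 : (⊤ : Submodule ℂ (ℕ →₀ ℂ)) ≤ LinearMap.ker (hermForm r) := by
    rw [← hspan, Submodule.span_le]
    rintro _ ⟨m, rfl⟩
    exact h1 m
  have h3 : hermForm r r = 0 := h2 (Submodule.mem_top (x := r))
  exact sub_eq_zero.1 (eq_zero_of_hermForm_self h3)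

section Conjugate

variable {A : Type*} [LinearOrder A] {σ : ℕ → A} {ε : ℂ} {ι w : ℕ → ℕ} {x v u : ℕ → ℕ →₀ ℂ}

/-- Orthogonality of `γ (x l)` to all `x m` with `m ≠ w l`, given that this line is already known
below `l`. -/
lemma hermForm_gammaInf_eq_zero (hσ : Function.Injective σ) (hι : ∀ ℓ, ι (ι ℓ) = ℓ)
    (htype : ε = 1 ∨ (ε = -1 ∧ ∀ ℓ, ι ℓ ≠ ℓ)) (hw : ∀ k, w (w k) = k)
    (hx : IsHermOrthonormal x)
    (hvlt : ∀ a, spanOn x {j | σ j < a} = spanOn v {j | σ j < a})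
    (hvle : ∀ a, spanOn x {j | σ j ≤ a} = spanOn v {j | σ j ≤ a})
    (hult : ∀ a, spanOn x {j | σ j < a} = spanOn u {j | σ j < a})
    (hule : ∀ a, spanOn x {j | σ j ≤ a} = spanOn u {j | σ j ≤ a})
    (hv : IsWDualInf ε ι w v) (hu : IsWConjInf ε ι w u) {l : ℕ}
    (ih : ∀ j, σ j < σ l → ∃ c : ℂ, gammaInf ε ι (x j) = c • x (w j)) {m : ℕ} (hm : m ≠ w l) :
    hermForm (x m) (gammaInf ε ι (x l)) = 0 := by
  have hmem (k : ℕ) : x k ∈ spanOn x {j | σ j ≤ σ k} :=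
    mem_spanOn (D := {j | σ j ≤ σ k}) (le_refl (σ k))
  by_cases hmw : ∃ j, σ j < σ l ∧ m = w j
  · obtain ⟨j, hj, rfl⟩ := hmw
    obtain ⟨c, hc⟩ := ih j hj
    have h1 := hermForm_gammaInf_gammaInf hι htype (x j) (x l)
    have h2 := hermForm_gammaInf_gammaInf hι htype (x j) (x j)
    rw [hx, if_neg fun e => hj.ne' (congrArg σ e), hc, hermForm_smul_left] at h1
    rw [hx, if_pos rfl, hc, hermForm_smul_left] at h2
    exact (mul_eq_zero.1 h1).resolve_left fun h0 => by simp [h0] at h2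
  push Not at hmw
  have hlow : ∀ z ∈ spanOn x {j | σ j < σ l}, hermForm (x m) (gammaInf ε ι z) = 0 := by
    intro z hz
    induction hz using Submodule.span_induction with
    | mem y hy =>
      obtain ⟨j, hj, rfl⟩ := hy
      obtain ⟨c, hc⟩ := ih j hj
      rw [hc, map_smul, hx, if_neg (hmw j hj), smul_zero]
    | zero => rw [gammaInf_zero, map_zero]
    | add y z _ _ h1 h2 => rw [gammaInf_add, map_add, h1, h2, add_zero]
    | smul c y _ h1 => rw [gammaInf_smul, map_smul, h1, smul_zero]
  have hred : ∀ (y z : ℕ →₀ ℂ) (c : ℂ), z ∈ spanOn x {j | σ j < σ l} → x l = c • y + z →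
      hermForm (x m) (gammaInf ε ι y) = 0 → hermForm (x m) (gammaInf ε ι (x l)) = 0 := by
    intro y z c hz he h0
    rw [he, gammaInf_add, gammaInf_smul, map_add, map_smul, h0, hlow z hz, smul_zero, add_zero]
  rcases lt_or_gt_of_ne (hσ.ne hm) with hlt | hgt
  · obtain ⟨c, z, hz, he⟩ := exists_sub_smul_mem_spanOn hσ (hvle (σ l) ▸ hmem l)
    refine hred _ z c (hvlt (σ l) ▸ hz) he (hermForm_eq_zero_symm ?_)
    refine hermForm_eq_zero_of_mem_spanOn (fun j (hj : σ j ≤ σ m) => ?_) (hvle (σ m) ▸ hmem m)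
    have hne : l ≠ w j := fun e => (hj.trans_lt hlt).ne (by rw [e, hw])
    rw [hermForm_gammaInf_left hι htype, (hv j l).1 hne, mul_zero]
  · obtain ⟨c, z, hz, he⟩ := exists_sub_smul_mem_spanOn hσ (hule (σ l) ▸ hmem l)
    refine hred _ z c (hult (σ l) ▸ hz) he ?_
    have hmu : u (w l) ∈ spanOn x {j | σ j ≤ σ (w l)} := by
      rw [hule]
      exact mem_spanOn (D := {j | σ j ≤ σ (w l)}) (le_refl (σ (w l)))
    have h0 : hermForm (x m) (u (w l)) = 0 :=
      hermForm_eq_zero_of_mem_spanOn (fun j (hj : σ j ≤ σ (w l)) => by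
        rw [hx, if_neg fun e => (hj.trans_lt hgt).ne (congrArg σ e.symm)]) hmu
    rcases hu l with h | h <;> simp [h, h0]

lemma exists_phases (hι : ∀ ℓ, ι (ι ℓ) = ℓ)
    (htype : ε = 1 ∨ (ε = -1 ∧ ∀ ℓ, ι ℓ ≠ ℓ)) (hw : InIinf ε ι w) {S : Set ℕ}
    (hx : IsHermOrthonormal x) (hxS : ∀ k ∉ S, x k = eB k) (hwS : ∀ k ∉ S, w k = ι k)
    (hwS' : ∀ k, k ∈ S → w k ∈ S)
    {c : ℕ → ℂ} (hc : ∀ k, gammaInf ε ι (x k) = c k • x (w k)) :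
    ∃ d : ℕ → ℂ, (∀ k, star (d k) * d k = 1) ∧ (∀ k ∉ S, d k = 1) ∧
      IsWConjInf ε ι w fun k => d k • x k := by
  obtain ⟨hw1, -, hw3⟩ := hw
  have hne : ∀ k, x k ≠ 0 := fun k h0 => by
    have := hx k k
    rw [h0, map_zero, if_pos rfl] at this
    exact zero_ne_one this
  have hcc : ∀ k, star (c k) * c k = 1 := by
    intro k
    have h := hermForm_gammaInf_gammaInf hι htype (x k) (x k)
    rwa [hc, hermForm_smul_left, map_smul, hx, hx, if_pos rfl, if_pos rfl, smul_eq_mul,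
      mul_one] at h
  have hcw : ∀ k, c (w k) = ε * c k := by
    intro k
    have h := gammaInf_gammaInf hι htype (x k)
    rw [hc, gammaInf_smul, hc, hw1, smul_smul] at h
    have h' := smul_left_injective ℂ (hne k) h
    linear_combination c k * h' - c (w k) * hcc k
  have hsq : ∀ k, ∃ d : ℂ, d ^ 2 = c k ∧ star d * d = 1 := by
    intro k
    obtain ⟨d, hd⟩ := IsAlgClosed.exists_pow_nat_eq (c k) (n := 2) (by norm_num)
    refine ⟨d, hd, ?_⟩
    have h := hcc k
    rw [← hd, star_pow, ← mul_pow, Complex.star_def, ← Complex.normSq_eq_conj_mul_self] at h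
    rw [Complex.star_def, ← Complex.normSq_eq_conj_mul_self]
    norm_cast at h ⊢
    exact (pow_eq_one_iff_of_nonneg (Complex.normSq_nonneg d) two_ne_zero).1 h
  choose r hr hr' using hsq
  classical
  set d : ℕ → ℂ := fun k =>
    if k ∉ S then 1 else if k < w k then 1 else if w k < k then c k else r k with hd
  have hd1 : ∀ k, star (d k) * d k = 1 := by
    intro k
    simp only [hd]
    split_ifs <;> first | exact hcc k | exact hr' k | simp
  have hdd : ∀ k, c k = d k * d (w k) ∨ c k = -(d k * d (w k)) := by
    intro k
    by_cases hk : k ∈ S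
    · have hk' := hwS' k hk
      simp only [hd, hk, hk', hw1]
      rcases lt_trichotomy k (w k) with h | h | h
      · simp only [h, h.not_gt]
        rcases htype with rfl | ⟨rfl, -⟩ <;> simp [hcw]
      · simp [← h, ← hr, sq]
      · simp [h, h.not_gt]
    · have hk' : w k ∉ S := fun h => hk (hw1 k ▸ hwS' _ h)
      have h := hc k
      rw [hxS k hk, hxS _ hk', gammaInf_eB, hwS k hk] at h
      have h' := smul_left_injective ℂ (m := eB (ι k)) (by simp [eB]) h
      have hd' : d k * d (w k) = 1 := by simp [hd, hk, hk']
      rw [hd', ← h']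
      rcases htype with rfl | ⟨rfl, -⟩ <;> split_ifs <;> simp
  refine ⟨d, hd1, fun k hk => by simp [hd, hk], fun k => ?_⟩
  rcases hdd k with h | h
  · left
    rw [gammaInf_smul, hc, smul_smul, h, ← mul_assoc, hd1, one_mul]
  · right
    rw [gammaInf_smul, hc, smul_smul, h, mul_neg, ← mul_assoc, hd1, one_mul, neg_smul]

end Conjugate

lemma exists_finite_isSupportedOn {v u : ℕ → ℕ →₀ ℂ} {ι w : ℕ → ℕ} (hw : ∀ k, w (w k) = k)
    (hfin : {ℓ : ℕ | w ℓ ≠ ι ℓ}.Finite)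
    (hv : {ℓ : ℕ | v ℓ ≠ eB ℓ}.Finite) (hu : {ℓ : ℕ | u ℓ ≠ eB ℓ}.Finite) :
    ∃ S : Set ℕ, S.Finite ∧ IsSupportedOn S v ∧ IsSupportedOn S u ∧ (∀ k ∉ S, w k = ι k) ∧
      ∀ k, k ∈ S → w k ∈ S := by
  set S₀ := {ℓ : ℕ | v ℓ ≠ eB ℓ} ∪ {ℓ : ℕ | u ℓ ≠ eB ℓ} ∪ {ℓ : ℕ | w ℓ ≠ ι ℓ} with hS₀
  have h₀ : S₀.Finite := (hv.union hu).union hfin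
  set S₁ := S₀ ∪ ⋃ k ∈ S₀, (((v k).support : Set ℕ) ∪ (u k).support) with hS₁
  have h₁ : S₁.Finite := h₀.union (h₀.biUnion fun k _ =>
    (Finset.finite_toSet _).union (Finset.finite_toSet _))
  have hsub : ∀ k ∈ S₀, ((v k).support : Set ℕ) ∪ (u k).support ⊆ S₁ := fun k hk =>
    (Set.subset_biUnion_of_mem (u := fun k => ((v k).support : Set ℕ) ∪ (u k).support) hk).trans
      Set.subset_union_right
  have hsupp : ∀ (y : ℕ → ℕ →₀ ℂ), {ℓ : ℕ | y ℓ ≠ eB ℓ} ⊆ S₀ →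
      (∀ k ∈ S₀, ((y k).support : Set ℕ) ⊆ S₁) → IsSupportedOn (S₁ ∪ w '' S₁) y := by
    intro y hy hy'
    refine ⟨fun k hk => by_contra fun h => hk (.inl (.inl (hy h))), fun k hk => ?_⟩
    by_cases h : k ∈ S₀
    · exact (hy' k h).trans Set.subset_union_left
    · have hk' : y k = eB k := by_contra fun h' => h (hy h')
      rw [hk', eB]
      intro i hi
      have := Finsupp.support_single_subset hi
      rw [Finset.mem_singleton] at this
      exact this ▸ hk
  refine ⟨S₁ ∪ w '' S₁, h₁.union (h₁.image w), hsupp v ?_ ?_, hsupp u ?_ ?_, ?_, ?_⟩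
  · exact fun k hk => .inl (.inl hk)
  · exact fun k hk => Set.subset_union_left.trans (hsub k hk)
  · exact fun k hk => .inl (.inr hk)
  · exact fun k hk => Set.subset_union_right.trans (hsub k hk)
  · exact fun k hk => by_contra fun h => hk (.inl (.inl (.inr h)))
  · rintro k (hk | ⟨j, hj, rfl⟩)
    · exact .inr ⟨k, hk, rfl⟩
    · rw [hw]
      exact .inl hj

lemma exists_dual_conjugate_basis {A : Type*} [LinearOrder A] {σ : ℕ → A}
    (hσ : Function.Injective σ) {ε : ℂ} {ι w : ℕ → ℕ} (hι : ∀ ℓ, ι (ι ℓ) = ℓ)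
    (htype : ε = 1 ∨ (ε = -1 ∧ ∀ ℓ, ι ℓ ≠ ℓ)) (hw : InIinf ε ι w) {v u : ℕ → ℕ →₀ ℂ}
    (hv : IsAdmBasis v) (hu : IsAdmBasis u) (hvd : IsWDualInf ε ι w v)
    (huc : IsWConjInf ε ι w u) (hflag : flagSet σ v = flagSet σ u) :
    ∃ y, IsAdmBasis y ∧ IsWDualInf ε ι w y ∧ IsWConjInf ε ι w y ∧
      flagSet σ v = flagSet σ y := by
  obtain ⟨S, hS, hvS, huS, hwS, hwS'⟩ :=
    exists_finite_isSupportedOn hw.1 hw.2.1 hv.2.2 hu.2.2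
  obtain ⟨x, hx, hxS, hxv⟩ := exists_gram_schmidt hσ hS hvS hv.1
  have hspan : ∀ {y : ℕ → ℕ →₀ ℂ}, (∀ k ∉ S, y k = eB k) →
      (∀ k, ∃ c : ℂ, c ≠ 0 ∧ ∃ z ∈ spanOn v {j | σ j < σ k}, y k = c • v k + z) →
      ∀ D : Set ℕ, (∀ i j, σ i ≤ σ j → j ∈ D → i ∈ D) → spanOn y D = spanOn v D :=
    fun h0 h1 _ hD => spanOn_eq_of_triangular hS (fun k hk => by rw [h0 k hk, hvS.1 k hk]) h1 hD
  have hlt : ∀ a i j, σ i ≤ σ j → j ∈ {j | σ j < a} → i ∈ {j | σ j < a} :=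
    fun a i j h h' => lt_of_le_of_lt h h'
  have hle : ∀ a i j, σ i ≤ σ j → j ∈ {j | σ j ≤ a} → i ∈ {j | σ j ≤ a} :=
    fun a i j h h' => le_trans h h'
  have htop : ∀ {y : ℕ → ℕ →₀ ℂ}, spanOn y Set.univ = spanOn v Set.univ →
      Submodule.span ℂ (Set.range y) = ⊤ := by
    intro y h
    rw [← Set.image_univ, ← hv.2.1, ← Set.image_univ (f := v)]
    exact h
  have huv := spanOn_eq_of_flagSet_eq hS hvS huS hv.1 hu.1 hflag
  have hline : ∀ k, ∃ c : ℂ, gammaInf ε ι (x k) = c • x (w k) := by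
    intro k
    induction k using induction_off_finite σ hS with
    | h0 k hk =>
      have hk' : w k ∉ S := fun h => hk (hw.1 k ▸ hwS' _ h)
      rw [hxS k hk, hxS _ hk', hwS k hk]
      exact ⟨_, gammaInf_eB ε ι k⟩
    | h1 k hk ih =>
      refine ⟨_, eq_hermForm_smul hx (htop (hspan hxS hxv _ (by simp))) fun m hm => ?_⟩
      have h1 := fun a => hspan hxS hxv _ (hlt a)
      have h2 := fun a => hspan hxS hxv _ (hle a)
      exact hermForm_gammaInf_eq_zero hσ hι htype hw.1 hx h1 h2
        (fun a => (h1 a).trans (huv a).1) (fun a => (h2 a).trans (huv a).2) hvd huc ih hm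
  choose c hc using hline
  obtain ⟨d, hd, hdS, hconj⟩ := exists_phases hι htype hw hx hxS hwS hwS' hc
  have hy : IsHermOrthonormal fun k => d k • x k := by
    intro i j
    rw [hermForm_smul_left, map_smul, hx]
    split_ifs with h
    · rw [h, smul_eq_mul, mul_one, hd]
    · simp
  have hyS : ∀ k ∉ S, d k • x k = eB k := fun k hk => by rw [hdS k hk, one_smul, hxS k hk]
  have hyv : ∀ k, ∃ c : ℂ, c ≠ 0 ∧ ∃ z ∈ spanOn v {j | σ j < σ k},
      d k • x k = c • v k + z := by
    intro k
    obtain ⟨c, hc, z, hz, he⟩ := hxv k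
    have hdk : d k ≠ 0 := right_ne_zero_of_mul_eq_one (hd k)
    exact ⟨d k * c, mul_ne_zero hdk hc, d k • z, Submodule.smul_mem _ _ hz, by
      rw [he, smul_add, smul_smul]⟩
  refine ⟨fun k => d k • x k, ⟨hy.linearIndependent, htop (hspan hyS hyv _ (by simp)), ?_⟩,
    hy.isWDualInf hι htype hw.1 hconj, hconj, ?_⟩
  · exact hS.subset fun k hk => by_contra fun h => hk (hyS k h)
  · simp only [flagSet_eq, hspan hyS hyv _ (hlt _), hspan hyS hyv _ (hle _)]

/-- for every `w ∈ 𝕀_∞^ε(ι)`,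
`𝓞_w ∩ 𝕺_w = {F_σ(v) : v admissible basis, simultaneously w-dual and w-conjugate}`,
and this set is nonempty. -/
theorem stmt_14 {A : Type*} [LinearOrder A] (σ : ℕ → A) (hσ : Function.Bijective σ)
    (ε : ℂ) (ι : ℕ → ℕ)
    (hι : ∀ ℓ, ι (ι ℓ) = ℓ)
    (hadj : ∀ ℓ, ι ℓ = ℓ + 1 ∨ ℓ = ι ℓ + 1 ∨ ι ℓ = ℓ)
    (htype : ε = 1 ∨ (ε = -1 ∧ ∀ ℓ, ι ℓ ≠ ℓ))
    (w : ℕ → ℕ) (hw : InIinf ε ι w) :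
    OsetInf σ ε ι w ∩ OOsetInf σ ε ι w =
      {S | ∃ v, IsAdmBasis v ∧ IsWDualInf ε ι w v ∧ IsWConjInf ε ι w v ∧ S = flagSet σ v} ∧
    (OsetInf σ ε ι w ∩ OOsetInf σ ε ι w).Nonempty := by
  refine ⟨Set.Subset.antisymm ?_ ?_, ?_⟩
  · rintro S ⟨⟨v, hv, hvd, rfl⟩, u, hu, huc, hflag⟩
    exact exists_dual_conjugate_basis hσ.injective hι htype hw hv hu hvd huc hflag
  · rintro S ⟨v, hv, hvd, hvc, rfl⟩
    exact ⟨⟨v, hv, hvd, rfl⟩, v, hv, hvc, rfl⟩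
  · obtain ⟨y, hy, ho, hc⟩ := exists_adapted_basis hι htype hw
    exact ⟨flagSet σ y, ⟨y, hy, ho.isWDualInf hι htype hw.1 hc, rfl⟩, y, hy, hc, rfl⟩
end
end
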